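/- Let D be a self-adjoint operator on a Hilbert space H and μ a bounded invertible operator with μ(dom D) ⊆ dom D such that both [D, μ]⟨D⟩^{-α} and ⟨D⟩^{-α}[D, μ] extend to bounded operators for some 0 ≤ α < 1, where ⟨D⟩ = (1+D²)^{1/2}. Then with D₁ = μDμ*, the operator (F_{D₁} - F_D)⟨D⟩^β is bounded for every β < 1 - α, where F_D = D(1+D²)^{-1/2}. -/

import Mathlib

namespace S19
open Filter Topology Set

noncomputable def g (θ t x : ℝ) : ℝ := if x ≤ 0 then 0 else x ^ (-θ) * Real.exp (-t / x)

lemma g_zero (θ t : ℝ) : g θ t 0 = 0 := by simp [g]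

lemma g_pos (θ t : ℝ) {x : ℝ} (hx : 0 < x) : g θ t x = x ^ (-θ) * Real.exp (-t / x) := by
  simp [g, not_le.mpr hx]

lemma g_nonneg (θ t x : ℝ) : 0 ≤ g θ t x := by
  rcases le_or_gt x 0 with hx | hx
  · simp [g, hx]
  · rw [g_pos _ _ hx]; positivity

lemma rpow_mul_exp_neg_le {y θ : ℝ} (hy : 0 < y) (h0 : 0 ≤ θ) (h3 : θ ≤ 3) :
    y ^ θ * Real.exp (-y) ≤ 6 := by
  have h1 : y ^ θ ≤ 6 * Real.exp y := by
    rcases le_or_gt y 1 with h | h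
    · have : y ^ θ ≤ 1 := Real.rpow_le_one hy.le h h0
      have := Real.add_one_le_exp y
      nlinarith
    · have h2 : y ^ θ ≤ y ^ (3 : ℝ) := Real.rpow_le_rpow_of_exponent_le h.le h3
      have h4 := Real.pow_div_factorial_le_exp y hy.le 3
      have h5 : y ^ (3 : ℝ) = y ^ 3 := by exact_mod_cast Real.rpow_natCast y 3
      rw [h5] at h2
      norm_num [Nat.factorial] at h4
      linarith
  rw [Real.exp_neg]
  rw [← div_eq_mul_inv, div_le_iff₀ (Real.exp_pos y)]
  exact h1

lemma g_le {θ t : ℝ} (ht : 0 < t) (h0 : 0 ≤ θ) (h3 : θ ≤ 3) (x : ℝ) :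
    g θ t x ≤ 6 * t ^ (-θ) := by
  rcases le_or_gt x 0 with hx | hx
  · simp [g, hx]; positivity
  · rw [g_pos _ _ hx]
    have hy : 0 < t / x := by positivity
    have := rpow_mul_exp_neg_le hy h0 h3
    have e : x ^ (-θ) * Real.exp (-t / x) = ((t / x) ^ θ * Real.exp (-(t / x))) * t ^ (-θ) := by
      rw [Real.div_rpow ht.le hx.le, Real.rpow_neg hx.le, Real.rpow_neg ht.le, neg_div]
      have := (Real.rpow_pos_of_pos ht θ).ne'
      field_simp
    rw [e]
    gcongr

lemma rpow_mul_g {a θ t x : ℝ} (hx : 0 ≤ x) : x ^ a * g θ t x = g (θ - a) t x := by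
  rcases hx.eq_or_lt with rfl | hx
  · simp [g_zero]
  · rw [g_pos _ _ hx, g_pos _ _ hx, ← mul_assoc, ← Real.rpow_add hx]
    congr 2; ring

lemma g_cont {θ t : ℝ} (ht : 0 < t) (h0 : 0 ≤ θ) (h2 : θ ≤ 2) :
    ContinuousOn (g θ t) (Ici 0) := by
  intro x hx
  rcases (mem_Ici.mp hx).eq_or_lt with rfl | hx
  · rw [ContinuousWithinAt, g_zero]
    have hb : ∀ y ∈ Ici (0:ℝ), g θ t y ≤ y * (6 * t ^ (-(θ + 1))) := by
      intro y hy
      have := rpow_mul_g (a := 1) (θ := θ + 1) (t := t) (mem_Ici.mp hy)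
      rw [show θ + 1 - 1 = θ by ring, Real.rpow_one] at this
      rw [← this]
      exact mul_le_mul_of_nonneg_left (g_le ht (by linarith) (by linarith) y) hy
    refine squeeze_zero' (Eventually.of_forall fun y => g_nonneg _ _ _)
      (eventually_mem_nhdsWithin.mono hb) ?_
    have : ContinuousAt (fun y : ℝ => y * (6 * t ^ (-(θ + 1)))) 0 := by fun_prop
    have h := this.tendsto
    simp only [zero_mul] at h
    exact h.mono_left nhdsWithin_le_nhds
  · apply ContinuousAt.continuousWithinAt
    have : ContinuousAt (fun y : ℝ => y ^ (-θ) * Real.exp (-t / y)) x := by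
      apply ContinuousAt.mul
      · exact Real.continuousAt_rpow_const _ _ (Or.inl hx.ne')
      · have : x ≠ 0 := hx.ne'
        fun_prop (disch := assumption)
    refine this.congr ?_
    filter_upwards [lt_mem_nhds hx] with y hy
    rw [g_pos _ _ hy]

lemma g_deriv_bound {t h : ℝ} (ht : 0 < t) (hh : |h| ≤ t / 2) (x : ℝ) :
    |g 0 (t + h) x - g 0 t x + h * g 1 t x| ≤ 6 * (t / 2) ^ (-2 : ℝ) * h ^ 2 := by
  rcases le_or_gt x 0 with hx | hx
  · simp [g, hx]; positivity
  · have hb := g_le (θ := 2) (t := t / 2) (by positivity) (by norm_num) (by norm_num) x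
    rw [g_pos _ _ hx] at hb
    rw [g_pos _ _ hx, g_pos _ _ hx, g_pos _ _ hx]
    have key : |Real.exp (-h / x) - (1 + -h / x)| ≤ |-h / x| ^ 2 * Real.exp |-h / x| := by
      have := Complex.norm_exp_sub_sum_le_norm_mul_exp ((-h / x : ℝ) : ℂ) 2
      simp only [Finset.sum_range_succ, Finset.sum_range_zero] at this
      norm_num at this
      have e : Complex.exp (-(h:ℂ) / x) - (1 + -(h:ℂ) / x) = ((Real.exp (-h / x) - (1 + -h / x) : ℝ) : ℂ) := by
        push_cast; ring
      rw [e, Complex.norm_real] at this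
      simpa [abs_div, abs_neg] using this
    have e1 : x ^ (-0:ℝ) * Real.exp (-(t + h) / x) - x ^ (-0:ℝ) * Real.exp (-t / x)
        + h * (x ^ (-1:ℝ) * Real.exp (-t / x))
        = Real.exp (-t / x) * (Real.exp (-h / x) - (1 + -h / x)) := by
      rw [show -(t + h) / x = -t / x + -h / x by ring, Real.exp_add, Real.rpow_neg_one]
      simp only [neg_zero, Real.rpow_zero]
      field_simp
      ring
    rw [e1, abs_mul, abs_of_pos (Real.exp_pos _)]
    have e2 : |-h / x| = |h| / x := by rw [abs_div, abs_neg, abs_of_pos hx]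
    rw [e2] at key
    calc Real.exp (-t / x) * |Real.exp (-h / x) - (1 + -h / x)|
        ≤ Real.exp (-t / x) * ((|h| / x) ^ 2 * Real.exp (|h| / x)) := by gcongr
      _ = (h ^ 2 / x ^ 2) * Real.exp (-t / x + |h| / x) := by
          rw [Real.exp_add, div_pow, sq_abs]; ring
      _ ≤ (h ^ 2 / x ^ 2) * Real.exp (-(t / 2) / x) := by
          gcongr
          rw [← add_div]
          gcongr
          linarith
      _ = h ^ 2 * (x ^ (-2:ℝ) * Real.exp (-(t / 2) / x)) := by
          rw [Real.rpow_neg hx.le]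
          norm_num
          ring
      _ ≤ h ^ 2 * (6 * (t / 2) ^ (-2 : ℝ)) := by gcongr
      _ = _ := by ring

lemma g_sub_bound {s x : ℝ} (hs : 0 < s) (hx : 0 ≤ x) : |(g 0 s x - 1) * x| ≤ s := by
  rcases hx.eq_or_lt with rfl | hx
  · simp [hs.le]
  · rw [g_pos _ _ hx]
    simp only [neg_zero, Real.rpow_zero, one_mul]
    have h1 := Real.add_one_le_exp (-s / x)
    have h2 : Real.exp (-s / x) ≤ 1 := by
      rw [Real.exp_le_one_iff, neg_div]
      have : 0 < s / x := by positivity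
      linarith
    rw [abs_mul, abs_of_pos hx, abs_of_nonpos (by linarith)]
    have : -s / x * x = -s := by field_simp
    nlinarith

lemma rpow_interp {p t x : ℝ} (hp0 : 0 ≤ p) (hp1 : p ≤ 1) (ht : 0 < t) (hx : 0 ≤ x) :
    x ^ p ≤ t ^ p + t ^ (p - 1) * x := by
  have a1 : 0 ≤ t ^ p := by positivity
  have a2 : 0 ≤ t ^ (p - 1) * x := by positivity
  rcases le_or_gt x t with h | h
  · have := Real.rpow_le_rpow hx h hp0
    linarith
  · have hx' : 0 < x := ht.trans h
    have : x ^ (p - 1) ≤ t ^ (p - 1) := Real.rpow_le_rpow_of_nonpos ht h.le (by linarith)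
    have e : x ^ p = x ^ (p - 1) * x := by
      rw [Real.rpow_sub_one hx'.ne']; field_simp
    rw [e]
    nlinarith

/-- integration lemma -/
lemma integ {E : Type*} [NormedAddCommGroup E] [NormedSpace ℝ E] (φ φ' : ℝ → E) (c θ : ℝ) (y : E)
    (hθ : θ < 1) (hd : ∀ t, 0 < t → HasDerivAt φ (φ' t) t)
    (hb : ∀ t, 0 < t → ‖φ' t‖ ≤ c * t ^ (-θ))
    (hl : Tendsto φ (𝓝[>] 0) (𝓝 y)) : ‖y‖ ≤ ‖φ 1‖ + c / (1 - θ) := by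
  have hθ' : 0 < 1 - θ := by linarith
  have hc : 0 ≤ c := by
    have := hb 1 one_pos
    simp at this
    exact (norm_nonneg _).trans this
  have key : ∀ s ∈ Ioo (0:ℝ) 1, ‖φ s‖ ≤ ‖φ 1‖ + c / (1 - θ) := by
    intro s hs
    set b : ℝ → ℝ := fun t => c / (1 - θ) * t ^ (1 - θ) - c / (1 - θ) * s ^ (1 - θ) with hbdef
    have hbd : ∀ t, 0 < t → HasDerivAt b (c * t ^ (-θ)) t := by
      intro t ht
      have h1 := (Real.hasDerivAt_rpow_const (x := t) (p := 1 - θ) (Or.inl ht.ne')).const_mul (c / (1 - θ))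
      have h2 := h1.sub_const (c / (1 - θ) * s ^ (1 - θ))
      convert! h2 using 1
      rw [show 1 - θ - 1 = -θ by ring]
      field_simp
    have hpos : ∀ t ∈ Icc s 1, 0 < t := fun t ht => hs.1.trans_le ht.1
    have := image_norm_le_of_norm_deriv_right_le_deriv_boundary' (a := s) (b := 1)
      (f := fun t => φ t - φ s) (f' := φ') (B := b) (B' := fun t => c * t ^ (-θ))
      (fun t ht => ((hd t (hpos t ht)).sub_const _).continuousAt.continuousWithinAt)
      (fun t ht => ((hd t (hpos t ⟨ht.1, ht.2.le⟩)).sub_const _).hasDerivWithinAt)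
      (by simp [hbdef])
      (fun t ht => (hbd t (hpos t ht)).continuousAt.continuousWithinAt)
      (fun t ht => (hbd t (hpos t ⟨ht.1, ht.2.le⟩)).hasDerivWithinAt)
      (fun t ht => hb t (hpos t ⟨ht.1, ht.2.le⟩)) (right_mem_Icc.mpr hs.2.le)
    have hb1 : b 1 ≤ c / (1 - θ) := by
      simp only [hbdef, Real.one_rpow, mul_one]
      have h1 : 0 ≤ s := hs.1.le
      have : 0 ≤ c / (1 - θ) * s ^ (1 - θ) := by positivity
      linarith
    have h3 : ‖φ s‖ ≤ ‖φ 1‖ + ‖φ 1 - φ s‖ := by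
      have := norm_sub_le (φ 1) (φ 1 - φ s)
      simpa using this
    linarith
  refine le_of_tendsto hl.norm ?_
  filter_upwards [Ioo_mem_nhdsGT (zero_lt_one (α := ℝ))] with s hs using key s hs

end S19

namespace S19
open Filter Topology Set ContinuousLinearMap

variable {H : Type*} [NormedAddCommGroup H] [InnerProductSpace ℂ H] [CompleteSpace H]

noncomputable def PW (Q : H →L[ℂ] H) (p : ℝ) : H →L[ℂ] H := cfc (fun t : ℝ => t ^ p) Q
noncomputable def EE (θ t : ℝ) (Q : H →L[ℂ] H) : H →L[ℂ] H := cfc (g θ t) Q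

lemma spec_nonneg {Q : H →L[ℂ] H} (hQ : Q.IsPositive) : ∀ x ∈ spectrum ℝ Q, 0 ≤ x := by
  have : 0 ≤ Q := (ContinuousLinearMap.nonneg_iff_isPositive Q).mpr hQ
  intro x hx
  exact spectrum_nonneg_of_nonneg this hx

lemma rpow_contOn {Q : H →L[ℂ] H} {p : ℝ} (hp : 0 ≤ p) :
    ContinuousOn (fun t : ℝ => t ^ p) (spectrum ℝ Q) :=
  (Real.continuous_rpow_const hp).continuousOn

lemma g_contOn {Q : H →L[ℂ] H} (hQ : Q.IsPositive) {θ t : ℝ} (ht : 0 < t) (h0 : 0 ≤ θ)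
    (h2 : θ ≤ 2) : ContinuousOn (g θ t) (spectrum ℝ Q) :=
  (g_cont ht h0 h2).mono fun x hx => spec_nonneg hQ x hx

lemma PW_add {Q : H →L[ℂ] H} (hQ : Q.IsPositive) {a b : ℝ} (ha : 0 ≤ a) (hb : 0 ≤ b) :
    PW Q (a + b) = PW Q a * PW Q b := by
  unfold PW
  rw [← cfc_mul _ _ Q (rpow_contOn ha) (rpow_contOn hb)]
  exact cfc_congr fun x hx => Real.rpow_add_of_nonneg (spec_nonneg hQ x hx) ha hb

lemma PW_one {Q : H →L[ℂ] H} (hQ : Q.IsPositive) : PW Q 1 = Q := by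
  unfold PW
  simp only [Real.rpow_one]
  exact cfc_id' ℝ Q hQ.isSelfAdjoint

lemma PW_zero {Q : H →L[ℂ] H} (hQ : Q.IsPositive) : PW Q 0 = 1 := by
  unfold PW
  simp only [Real.rpow_zero]
  exact cfc_const_one ℝ Q hQ.isSelfAdjoint

lemma PW_sa (Q : H →L[ℂ] H) (p : ℝ) : IsSelfAdjoint (PW Q p) := cfc_predicate _ _

lemma PW_comm {Q F : H →L[ℂ] H} (h : F * Q = Q * F) (p : ℝ) : F * PW Q p = PW Q p * F := by
  have : Commute Q F := h.symm
  exact (this.cfc_real (fun t : ℝ => t ^ p)).eq.symm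

lemma PW_inj {Q : H →L[ℂ] H} (hQ : Q.IsPositive) (hi : Function.Injective Q) {p : ℝ}
    (h0 : 0 ≤ p) (h1 : p ≤ 1) : Function.Injective (PW Q p) := by
  have e : PW Q (1 - p) * PW Q p = Q := by
    rw [← PW_add hQ (by linarith) h0, sub_add_cancel, PW_one hQ]
  have : Function.Injective ((PW Q (1 - p)) ∘ (PW Q p)) := by
    rw [← ContinuousLinearMap.coe_comp, ← ContinuousLinearMap.mul_def, e]; exact hi
  exact this.of_comp

lemma PW_interp {Q : H →L[ℂ] H} (hQ : Q.IsPositive) {p t : ℝ} (h0 : 0 ≤ p) (h1 : p ≤ 1)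
    (ht : 0 < t) (y : H) : ‖PW Q p y‖ ≤ t ^ p * ‖y‖ + t ^ (p - 1) * ‖Q y‖ := by
  set w : ℝ → ℝ := fun x => t ^ p + t ^ (p - 1) * x with hw
  have hwpos : ∀ x ∈ spectrum ℝ Q, 0 < w x := fun x hx => by
    have := spec_nonneg hQ x hx
    simp only [hw]; positivity
  have hwc : ContinuousOn w (spectrum ℝ Q) := by fun_prop
  have hrc : ContinuousOn (fun x => x ^ p / w x) (spectrum ℝ Q) :=
    (rpow_contOn h0).div hwc fun x hx => (hwpos x hx).ne'
  have e : PW Q p = cfc (fun x => x ^ p / w x) Q * cfc w Q := by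
    rw [← cfc_mul _ _ Q hrc hwc]
    refine cfc_congr fun x hx => ?_
    exact (div_mul_cancel₀ _ (hwpos x hx).ne').symm
  have ew : cfc w Q = (t ^ p) • (1 : H →L[ℂ] H) + (t ^ (p - 1)) • Q := by
    simp only [hw]
    rw [cfc_add (a := Q) (fun _ => t ^ p) (fun x => t ^ (p - 1) * x), cfc_const_mul _ _ Q,
      cfc_id' ℝ Q hQ.isSelfAdjoint, cfc_const _ Q hQ.isSelfAdjoint, Algebra.algebraMap_eq_smul_one]
  have hr : ‖cfc (fun x => x ^ p / w x) Q‖ ≤ 1 := by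
    refine norm_cfc_le zero_le_one fun x hx => ?_
    have hx0 := spec_nonneg hQ x hx
    have h2 := hwpos x hx
    rw [Real.norm_of_nonneg (by positivity), div_le_one h2]
    exact rpow_interp h0 h1 ht hx0
  rw [e, ew]
  calc _ ≤ 1 * ‖((t ^ p) • (1 : H →L[ℂ] H) + (t ^ (p - 1)) • Q) y‖ :=
        (le_opNorm (cfc (fun x => x ^ p / w x) Q) _).trans
          (mul_le_mul_of_nonneg_right hr (norm_nonneg _))
    _ ≤ _ := by
        rw [one_mul]
        change ‖(t ^ p) • y + (t ^ (p - 1)) • Q y‖ ≤ _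
        refine (norm_add_le _ _).trans ?_
        rw [norm_smul, norm_smul]
        rw [Real.norm_of_nonneg (by positivity), Real.norm_of_nonneg (by positivity)]

lemma EE_norm {Q : H →L[ℂ] H} {θ t : ℝ} (ht : 0 < t) (h0 : 0 ≤ θ)
    (h2 : θ ≤ 2) : ‖EE θ t Q‖ ≤ 6 * t ^ (-θ) := by
  refine norm_cfc_le (by positivity) fun x _ => ?_
  rw [Real.norm_of_nonneg (g_nonneg _ _ _)]
  exact g_le ht h0 (by linarith) x

lemma PW_mul_EE {Q : H →L[ℂ] H} (hQ : Q.IsPositive) {a θ t : ℝ} (ht : 0 < t) (h0 : 0 ≤ θ)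
    (h2 : θ ≤ 2) (ha : 0 ≤ a) : PW Q a * EE θ t Q = EE (θ - a) t Q := by
  unfold PW EE
  rw [← cfc_mul _ _ Q (rpow_contOn ha) (g_contOn hQ ht h0 h2)]
  exact cfc_congr fun x hx => rpow_mul_g (spec_nonneg hQ x hx)

lemma EE_mul_PW {Q : H →L[ℂ] H} (hQ : Q.IsPositive) {a θ t : ℝ} (ht : 0 < t) (h0 : 0 ≤ θ)
    (h2 : θ ≤ 2) (ha : 0 ≤ a) : EE θ t Q * PW Q a = EE (θ - a) t Q := by
  rw [← PW_mul_EE hQ ht h0 h2 ha]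
  exact (cfc_commute_cfc _ _ Q).eq

lemma EE_deriv {Q : H →L[ℂ] H} (hQ : Q.IsPositive) {t : ℝ} (ht : 0 < t) :
    HasDerivAt (fun s => EE 0 s Q) (-EE 1 t Q) t := by
  rw [hasDerivAt_iff_isLittleO_nhds_zero]
  have hO : (fun h => EE 0 (t + h) Q - EE 0 t Q - h • (-EE 1 t Q)) =O[𝓝 0] fun h : ℝ => h ^ 2 := by
    refine Asymptotics.IsBigO.of_bound (6 * (t / 2) ^ (-2 : ℝ)) ?_
    have : ∀ᶠ h : ℝ in 𝓝 0, |h| < t / 2 := by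
      have : ContinuousAt (fun h : ℝ => |h|) 0 := by fun_prop
      exact this.eventually_lt continuousAt_const (by simpa using half_pos ht)
    filter_upwards [this] with h hh
    have hth : 0 < t + h := by linarith [neg_abs_le h]
    have c1 := g_contOn hQ hth le_rfl (zero_le_two)
    have c2 := g_contOn hQ ht le_rfl (zero_le_two)
    have c3 := g_contOn hQ ht zero_le_one (one_le_two)
    have e : EE 0 (t + h) Q - EE 0 t Q - h • (-EE 1 t Q)
        = cfc (fun x => g 0 (t + h) x - g 0 t x + h * g 1 t x) Q := by
      unfold EE
      rw [cfc_add (a := Q) (fun x => g 0 (t + h) x - g 0 t x) (fun x => h * g 1 t x)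
        (c1.sub c2) (continuousOn_const.mul c3), cfc_sub _ _ Q c1 c2, cfc_const_mul _ _ Q c3]
      simp
    rw [e]
    refine (norm_cfc_le (c := 6 * (t / 2) ^ (-2 : ℝ) * h ^ 2) (by positivity) fun x _ => ?_).trans ?_
    · exact g_deriv_bound ht hh.le x
    · rw [Real.norm_of_nonneg (by positivity)]
  refine hO.trans_isLittleO ?_
  exact Asymptotics.isLittleO_pow_id one_lt_two

lemma dense_of_inj {Q : H →L[ℂ] H} (hQ : IsSelfAdjoint Q) (hi : Function.Injective Q) :
    DenseRange Q := by
  have h1 : (Q.range)ᗮ = ⊥ := by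
    rw [ContinuousLinearMap.orthogonal_range, hQ.adjoint_eq]
    exact LinearMap.ker_eq_bot.mpr hi
  have h2 := Submodule.topologicalClosure_eq_top_iff.mpr h1
  have h3 := Submodule.dense_iff_topologicalClosure_eq_top.mpr h2
  exact h3

lemma EE_norm0 {Q : H →L[ℂ] H} {t : ℝ} (ht : 0 < t) : ‖EE 0 t Q‖ ≤ 6 := by
  simpa using EE_norm (Q := Q) ht le_rfl zero_le_two

lemma EE_tendsto {Q : H →L[ℂ] H} (hQ : Q.IsPositive) (hi : Function.Injective Q) (x : H) :
    Tendsto (fun s => EE 0 s Q x) (𝓝[>] 0) (𝓝 x) := by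
  rw [Metric.tendsto_nhds]
  intro ε hε
  obtain ⟨v, hv⟩ := (dense_of_inj hQ.isSelfAdjoint hi).exists_dist_lt x (ε := ε / 16) (by positivity)
  have hs : ∀ s, 0 < s → ‖EE 0 s Q (Q v) - Q v‖ ≤ s * ‖v‖ := by
    intro s hs
    have c := g_contOn hQ hs le_rfl (zero_le_two)
    have e : EE 0 s Q * Q - Q = cfc (fun x => (g 0 s x - 1) * x) Q := by
      unfold EE
      rw [cfc_mul (a := Q) (fun x => g 0 s x - 1) (fun x => x) (c.sub continuousOn_const)
        continuousOn_id, cfc_sub _ _ Q c continuousOn_const, cfc_const_one ℝ Q hQ.isSelfAdjoint,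
        cfc_id' ℝ Q hQ.isSelfAdjoint, sub_mul, one_mul]
    have : EE 0 s Q (Q v) - Q v = (EE 0 s Q * Q - Q) v := rfl
    rw [this, e]
    refine (le_opNorm _ _).trans ?_
    gcongr
    exact norm_cfc_le hs.le fun x hx => g_sub_bound hs (spec_nonneg hQ x hx)
  have hev : ∀ᶠ s : ℝ in 𝓝[>] 0, s * ‖v‖ < ε / 2 := by
    apply Filter.Eventually.filter_mono nhdsWithin_le_nhds
    have : ContinuousAt (fun s : ℝ => s * ‖v‖) 0 := by fun_prop
    exact this.eventually_lt continuousAt_const (by simpa using half_pos hε)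
  filter_upwards [hev, self_mem_nhdsWithin] with s h1 h2
  have h2' : 0 < s := h2
  rw [dist_eq_norm] at hv ⊢
  have e : EE 0 s Q x - x = EE 0 s Q (x - Q v) + (EE 0 s Q (Q v) - Q v) - (x - Q v) := by
    rw [map_sub]; abel
  rw [e]
  have a1 := norm_sub_le (EE 0 s Q (x - Q v) + (EE 0 s Q (Q v) - Q v)) (x - Q v)
  have a2 := norm_add_le (EE 0 s Q (x - Q v)) (EE 0 s Q (Q v) - Q v)
  have a3 : ‖EE 0 s Q (x - Q v)‖ ≤ 6 * ‖x - Q v‖ :=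
    (le_opNorm _ _).trans (by gcongr; exact EE_norm0 h2')
  have a4 := hs s h2'
  linarith

/-- factorization -/
lemma factor {T S : H →L[ℂ] H} (hS : IsSelfAdjoint S) (hi : Function.Injective S)
    (h : ∃ C : ℝ, ∀ x, ‖T x‖ ≤ C * ‖S x‖) : ∃ N : H →L[ℂ] H, T = N * S := by
  refine ⟨(T : H →ₗ[ℂ] H).extendOfNorm (S : H →ₗ[ℂ] H), ?_⟩
  ext x
  exact (LinearMap.extendOfNorm_eq (f := (T : H →ₗ[ℂ] H)) (e := (S : H →ₗ[ℂ] H))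
    (dense_of_inj hS hi) h x).symm

lemma factor_left {T Q : H →L[ℂ] H} (hi : Function.Injective Q)
    (h : ∀ ξ, ∃ η, T ξ = Q η) : ∃ M : H →L[ℂ] H, T = Q * M := by
  choose m hm using h
  let L : H →ₗ[ℂ] H :=
    { toFun := m
      map_add' := fun x y => hi (by rw [map_add, ← hm, ← hm, ← hm, map_add])
      map_smul' := fun c x => hi (by simp [← hm]) }
  have hc : IsClosed (L.graph : Set (H × H)) := by
    have : (L.graph : Set (H × H)) = {p | T p.1 = Q p.2} := by
      ext p
      simp only [SetLike.mem_coe, LinearMap.mem_graph_iff, Set.mem_ofPred_eq]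
      change p.2 = m p.1 ↔ _
      rw [hm]
      exact ⟨fun h => by rw [h], fun h => (hi h).symm⟩
    rw [this]
    exact isClosed_eq (by fun_prop) (by fun_prop)
  refine ⟨ContinuousLinearMap.ofIsClosedGraph hc, ?_⟩
  ext x
  exact hm x

lemma sylvester {A B X V : H →L[ℂ] H} (hA : A.IsPositive) (hAi : Function.Injective A)
    (hB : B.IsPositive) (hBi : Function.Injective B) {p β : ℝ} (hβ : 0 ≤ β) (hβp : β < p)
    (hp : p ≤ 1) (h : A * X + X * B = A * V * PW B p) :
    ∃ C : ℝ, ∀ ζ, ‖X ζ‖ ≤ C * ‖PW B β ζ‖ := by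
  set θ : ℝ := 1 - p + β with hθ
  refine ⟨6 * ‖X‖ * 6 + 6 * ‖V‖ * 6 / (1 - θ), fun ζ => ?_⟩
  have hd : ∀ t, 0 < t → HasDerivAt (fun s => (EE 0 s A * X * EE 0 s B) ζ)
      (-(EE 0 t A (V (EE θ t B (PW B β ζ))))) t := by
    intro t ht
    have h1 := ((EE_deriv hA ht).mul_const X).mul (EE_deriv hB ht)
    have eA : EE 1 t A * A = EE 0 t A := by
      have := EE_mul_PW hA (a := 1) (θ := 1) ht zero_le_one one_le_two zero_le_one
      rwa [PW_one hA, sub_self] at this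
    have eB : B * EE 1 t B = EE 0 t B := by
      have := PW_mul_EE hB (a := 1) (θ := 1) ht zero_le_one one_le_two zero_le_one
      rwa [PW_one hB, sub_self] at this
    have e2 : PW B p * EE 1 t B = EE θ t B * PW B β := by
      rw [PW_mul_EE hB ht zero_le_one one_le_two (by linarith),
        EE_mul_PW hB ht (by linarith) (by linarith) hβ]
      congr 1; rw [hθ]; ring
    have e : -EE 1 t A * X * EE 0 t B + EE 0 t A * X * -EE 1 t B
        = -(EE 0 t A * V * (EE θ t B * PW B β)) := by
      rw [← e2, ← eB, ← eA]
      calc _ = -(EE 1 t A * (A * X + X * B) * EE 1 t B) := by noncomm_ring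
        _ = _ := by rw [h]; noncomm_ring
    rw [e] at h1
    exact ((ContinuousLinearMap.apply ℂ H ζ).restrictScalars ℝ).hasFDerivAt.comp_hasDerivAt t h1
  have hb : ∀ t, 0 < t → ‖-(EE 0 t A (V (EE θ t B (PW B β ζ))))‖
      ≤ (6 * ‖V‖ * 6 * ‖PW B β ζ‖) * t ^ (-θ) := by
    intro t ht
    rw [norm_neg]
    calc _ ≤ 6 * (‖V‖ * ((6 * t ^ (-θ)) * ‖PW B β ζ‖)) := by
          refine (le_opNorm _ _).trans ?_
          gcongr
          · exact EE_norm0 ht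
          refine (le_opNorm _ _).trans ?_
          gcongr
          refine (le_opNorm _ _).trans ?_
          gcongr
          exact EE_norm ht (by linarith) (by linarith)
      _ = _ := by ring
  have hl : Tendsto (fun s => (EE 0 s A * X * EE 0 s B) ζ) (𝓝[>] 0) (𝓝 (X ζ)) := by
    have h1 := EE_tendsto hA hAi (X ζ)
    have h2 : Tendsto (fun s => EE 0 s A (X (EE 0 s B ζ - ζ))) (𝓝[>] 0) (𝓝 0) := by
      have h3 : Tendsto (fun s => 6 * ‖X (EE 0 s B ζ - ζ)‖) (𝓝[>] 0) (𝓝 0) := by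
        have h4 := (EE_tendsto hB hBi ζ).sub_const ζ
        have h5 := ((X.continuous.tendsto _).comp h4).norm.const_mul 6
        simpa using h5
      refine squeeze_zero_norm' ?_ h3
      filter_upwards [self_mem_nhdsWithin] with s hs
      exact (le_opNorm _ _).trans (by gcongr; exact EE_norm0 hs)
    have h3 := h2.add h1
    rw [zero_add] at h3
    refine h3.congr fun s => ?_
    simp
  have := integ _ _ _ _ _ (by linarith : θ < 1) hd hb hl
  have h1 : ‖(EE 0 1 A * X * EE 0 1 B) ζ‖ ≤ 6 * ‖X‖ * 6 * ‖PW B β ζ‖ := by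
    have e : EE 0 1 B = EE β 1 B * PW B β := by
      rw [EE_mul_PW hB one_pos hβ (by linarith) hβ, sub_self]
    rw [e]
    change ‖EE 0 1 A (X (EE β 1 B (PW B β ζ)))‖ ≤ _
    calc _ ≤ 6 * (‖X‖ * ((6 * 1 ^ (-β)) * ‖PW B β ζ‖)) := by
          refine (le_opNorm _ _).trans ?_
          gcongr
          · exact EE_norm0 one_pos
          refine (le_opNorm _ _).trans ?_
          gcongr
          refine (le_opNorm _ _).trans ?_
          gcongr
          exact EE_norm one_pos (by linarith) (by linarith)
      _ = _ := by rw [Real.one_rpow]; ring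
  calc _ ≤ _ := this
    _ ≤ 6 * ‖X‖ * 6 * ‖PW B β ζ‖ + 6 * ‖V‖ * 6 * ‖PW B β ζ‖ / (1 - θ) := by gcongr
    _ = _ := by ring

set_option maxHeartbeats 1000000 in
lemma heinz {A B T : H →L[ℂ] H} (hA : A.IsPositive)
    (hB : B.IsPositive) (hBi : Function.Injective B) {p q : ℝ} (hq : 0 ≤ q) (hqp : q < p)
    (hp : p ≤ 1) (h : ∃ C : ℝ, ∀ ζ, ‖A (T ζ)‖ ≤ C * ‖B ζ‖) :
    ∃ C : ℝ, ∀ ζ, ‖PW A p (T ζ)‖ ≤ C * ‖PW B q ζ‖ := by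
  obtain ⟨C₀, hC₀⟩ := h
  obtain ⟨C, hC0, hC⟩ : ∃ C : ℝ, 0 ≤ C ∧ ∀ ζ, ‖A (T ζ)‖ ≤ C * ‖B ζ‖ :=
    ⟨|C₀|, abs_nonneg _, fun ζ => (hC₀ ζ).trans (by gcongr; exact le_abs_self _)⟩
  set θ : ℝ := 1 - p + q with hθ
  set S := PW A p * T with hS
  refine ⟨‖S‖ * 6 + (‖T‖ * 6 + C * 6) / (1 - θ), fun ζ => ?_⟩
  have hd : ∀ t, 0 < t → HasDerivAt (fun s => (S * EE 0 s B) ζ) ((S * -EE 1 t B) ζ) t := by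
    intro t ht
    have h1 := (EE_deriv hB ht).const_mul S
    exact ((ContinuousLinearMap.apply ℂ H ζ).restrictScalars ℝ).hasFDerivAt.comp_hasDerivAt t h1
  have hb : ∀ t, 0 < t → ‖(S * -EE 1 t B) ζ‖
      ≤ ((‖T‖ * 6 + C * 6) * ‖PW B q ζ‖) * t ^ (-θ) := by
    intro t ht
    have e1 : EE 1 t B = EE (1 + q) t B * PW B q := by
      rw [EE_mul_PW hB ht (by linarith) (by linarith) hq]
      congr 1; ring
    have e2 : B * EE 1 t B = EE q t B * PW B q := by
      have := PW_mul_EE hB (a := 1) (θ := 1) ht zero_le_one one_le_two zero_le_one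
      rw [PW_one hB, sub_self] at this
      rw [this, EE_mul_PW hB ht hq (by linarith) hq, sub_self]
    have n1 : ‖EE 1 t B ζ‖ ≤ 6 * t ^ (-(1 + q)) * ‖PW B q ζ‖ := by
      rw [e1]
      change ‖EE (1 + q) t B (PW B q ζ)‖ ≤ _
      refine (le_opNorm _ _).trans ?_
      gcongr
      exact EE_norm ht (by linarith) (by linarith)
    have n2 : ‖B (EE 1 t B ζ)‖ ≤ 6 * t ^ (-q) * ‖PW B q ζ‖ := by
      change ‖(B * EE 1 t B) ζ‖ ≤ _
      rw [e2]
      change ‖EE q t B (PW B q ζ)‖ ≤ _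
      refine (le_opNorm _ _).trans ?_
      gcongr
      exact EE_norm ht (by linarith) (by linarith)
    have : (S * -EE 1 t B) ζ = -(PW A p (T (EE 1 t B ζ))) := by
      rw [mul_neg, hS]; rfl
    rw [this, norm_neg]
    refine (PW_interp hA (by linarith) hp ht _).trans ?_
    calc _ ≤ t ^ p * (‖T‖ * (6 * t ^ (-(1 + q)) * ‖PW B q ζ‖))
            + t ^ (p - 1) * (C * (6 * t ^ (-q) * ‖PW B q ζ‖)) := by
          gcongr
          · exact (le_opNorm _ _).trans (by gcongr)
          · exact (hC _).trans (by gcongr)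
      _ = ‖T‖ * 6 * ‖PW B q ζ‖ * (t ^ p * t ^ (-(1 + q)))
            + C * 6 * ‖PW B q ζ‖ * (t ^ (p - 1) * t ^ (-q)) := by ring
      _ = _ := by
          rw [← Real.rpow_add ht, ← Real.rpow_add ht, show p + -(1 + q) = -θ by rw [hθ]; ring,
            show p - 1 + -q = -θ by rw [hθ]; ring]
          ring
  have hl : Tendsto (fun s => (S * EE 0 s B) ζ) (𝓝[>] 0) (𝓝 (S ζ)) :=
    (S.continuous.tendsto _).comp (EE_tendsto hB hBi ζ)
  have := integ _ _ _ _ _ (by linarith : θ < 1) hd hb hl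
  have h1 : ‖(S * EE 0 1 B) ζ‖ ≤ ‖S‖ * 6 * ‖PW B q ζ‖ := by
    have e : EE 0 1 B = EE q 1 B * PW B q := by
      rw [EE_mul_PW hB one_pos hq (by linarith) hq, sub_self]
    rw [e]
    change ‖S (EE q 1 B (PW B q ζ))‖ ≤ _
    calc _ ≤ ‖S‖ * ((6 * 1 ^ (-q)) * ‖PW B q ζ‖) := by
          refine (le_opNorm _ _).trans ?_
          gcongr
          refine (le_opNorm _ _).trans ?_
          gcongr
          exact EE_norm one_pos (by linarith) (by linarith)
      _ = _ := by rw [Real.one_rpow]; ring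
  calc _ ≤ _ := this
    _ ≤ ‖S‖ * 6 * ‖PW B q ζ‖ + (‖T‖ * 6 + C * 6) * ‖PW B q ζ‖ / (1 - θ) := by gcongr
    _ = _ := by ring

end S19

namespace S19
open Filter Topology Set ContinuousLinearMap

section
variable {H : Type*} [NormedAddCommGroup H] [InnerProductSpace ℂ H] [CompleteSpace H]

lemma S_props {F Q : H →L[ℂ] H} (hQ : IsSelfAdjoint Q)
    (hF : IsSelfAdjoint F) (hFQ : F * Q = Q * F) (hpyth : F * F + Q * Q = 1) {l : ℝ} (hl : 1 ≤ l) :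
    ∃ S R : H →L[ℂ] H, S = F + ((l : ℂ) * Complex.I) • Q ∧ S * R = 1 ∧ R * S = 1 ∧
      (∀ y, ‖y‖ ≤ ‖S y‖) ∧ (∀ y, l * ‖Q y‖ ≤ ‖S y‖) := by
  set S : H →L[ℂ] H := F + ((l : ℂ) * Complex.I) • Q with hS
  have hstar : star S = F - ((l : ℂ) * Complex.I) • Q := by
    rw [hS, star_add, star_smul, hF.star_eq, hQ.star_eq]
    simp [sub_eq_add_neg]
  have hI : ((l : ℂ) * Complex.I) * ((l : ℂ) * Complex.I) = -((l^2 : ℝ) : ℂ) := by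
    push_cast
    linear_combination (l:ℂ)^2 * Complex.I_mul_I
  have hcomm1 : star S * S = F * F + ((l ^ 2 : ℝ) : ℂ) • (Q * Q) := by
    rw [hstar, hS]
    simp only [sub_mul, mul_add, smul_mul_assoc, mul_smul_comm, hFQ, smul_sub]
    rw [smul_smul, hI, neg_smul]; abel
  have hcomm2 : S * star S = F * F + ((l ^ 2 : ℝ) : ℂ) • (Q * Q) := by
    rw [hstar, hS]
    simp only [mul_sub, add_mul, smul_mul_assoc, mul_smul_comm, hFQ, smul_add]
    rw [smul_smul, hI, neg_smul]; abel
  have hnorm : ∀ y, ‖S y‖ ^ 2 = ‖F y‖ ^ 2 + l ^ 2 * ‖Q y‖ ^ 2 := by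
    intro y
    have e1 : ∀ T : H →L[ℂ] H, ((‖T y‖ ^ 2 : ℝ) : ℂ) = inner ℂ y ((star T * T) y) := by
      intro T
      rw [ContinuousLinearMap.star_eq_adjoint]
      change _ = inner ℂ y (adjoint T (T y))
      rw [ContinuousLinearMap.adjoint_inner_right, inner_self_eq_norm_sq_to_K]
      push_cast; rfl
    have h1 := e1 S
    have h2 := e1 F
    have h3 := e1 Q
    rw [hF.star_eq] at h2
    rw [hQ.star_eq] at h3
    rw [hcomm1] at h1
    have h4 : inner ℂ y ((F * F + ((l ^ 2 : ℝ) : ℂ) • (Q * Q)) y)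
        = inner ℂ y ((F * F) y) + ((l ^ 2 : ℝ) : ℂ) * inner ℂ y ((Q * Q) y) := by
      change inner ℂ y ((F * F) y + ((l ^ 2 : ℝ) : ℂ) • ((Q * Q) y)) = _
      rw [inner_add_right, inner_smul_right]
    rw [h4, ← h2, ← h3] at h1
    exact_mod_cast h1
  have hpy : ∀ y, ‖F y‖ ^ 2 + ‖Q y‖ ^ 2 = ‖y‖ ^ 2 := by
    intro y
    have e1 : ∀ T : H →L[ℂ] H, IsSelfAdjoint T → ((‖T y‖ ^ 2 : ℝ) : ℂ) = inner ℂ y ((T * T) y) := by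
      intro T hT
      nth_rewrite 2 [← hT.star_eq]
      rw [ContinuousLinearMap.star_eq_adjoint]
      change _ = inner ℂ y (adjoint T (T y))
      rw [ContinuousLinearMap.adjoint_inner_right, inner_self_eq_norm_sq_to_K]
      push_cast; rfl
    have h2 := e1 F hF
    have h3 := e1 Q hQ
    have h4 : inner ℂ y ((F * F) y) + inner ℂ y ((Q * Q) y) = ((‖y‖ ^ 2 : ℝ) : ℂ) := by
      rw [← inner_add_right]
      change inner ℂ y ((F * F + Q * Q) y) = _
      rw [hpyth]
      change inner ℂ y y = _
      rw [inner_self_eq_norm_sq_to_K]; push_cast; rfl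
    rw [← h2, ← h3] at h4
    exact_mod_cast h4
  have hunit : IsUnit S := by
    have hc : Commute (star S) S := hcomm1.trans hcomm2.symm
    have hu : IsUnit (star S * S) := by
      have e : star S * S = 1 + ((l ^ 2 - 1 : ℝ) : ℂ) • (Q * Q) := by
        rw [hcomm1, ← hpyth]; push_cast; rw [sub_smul]; simp
      have e2 : ((l ^ 2 - 1 : ℝ) : ℂ) • (Q * Q)
          = star (((Real.sqrt (l ^ 2 - 1) : ℝ) : ℂ) • Q) * (((Real.sqrt (l ^ 2 - 1) : ℝ) : ℂ) • Q) := by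
        have e3 : (l ^ 2 - 1 : ℝ) = Real.sqrt (l ^ 2 - 1) * Real.sqrt (l ^ 2 - 1) :=
          (Real.mul_self_sqrt (by nlinarith)).symm
        rw [star_smul, hQ.star_eq, smul_mul_assoc, mul_smul_comm, smul_smul]
        nth_rewrite 1 [e3]
        simp
      refine CStarAlgebra.isUnit_of_le (1 : H →L[ℂ] H) (b := star S * S) ?_
        (isUnit_one.isStrictlyPositive zero_le_one)
      rw [e, e2]
      exact le_add_of_nonneg_right (star_mul_self_nonneg _)
    exact (hc.isUnit_mul_iff.mp hu).2
  obtain ⟨u, hu⟩ := hunit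
  refine ⟨S, ((u⁻¹ : (H →L[ℂ] H)ˣ) : H →L[ℂ] H), rfl, ?_, ?_, ?_, ?_⟩
  · rw [← hu]; exact u.mul_inv
  · rw [← hu]; exact u.inv_mul
  · intro y
    refine (sq_le_sq₀ (norm_nonneg _) (norm_nonneg _)).mp ?_
    rw [hnorm, ← hpy]
    have : 1 ≤ l ^ 2 := by nlinarith
    have := sq_nonneg ‖Q y‖
    nlinarith
  · intro y
    refine (sq_le_sq₀ (by positivity) (norm_nonneg _)).mp ?_
    rw [hnorm]
    have := sq_nonneg ‖F y‖
    nlinarith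

lemma apriori {F Q μ ν B : H →L[ℂ] H} (hQ : Q.IsPositive)
    (hF : IsSelfAdjoint F) (hFQ : F * Q = Q * F) (hpyth : F * F + Q * Q = 1)
    (hνμ : ν * μ = 1) {α : ℝ} (h0 : 0 ≤ α) (h1 : α < 1)
    (hJ : F * μ * Q - Q * μ * F = PW Q (1 - α) * B * Q) :
    (∃ C : ℝ, ∀ ζ, ‖Q (μ ζ)‖ ≤ C * ‖Q ζ‖) ∧ (∃ C : ℝ, ∀ ζ, ‖Q ζ‖ ≤ C * ‖Q (μ ζ)‖) := by
  obtain ⟨l, hl1, hl2⟩ : ∃ l : ℝ, 1 ≤ l ∧ ‖ν‖ * (2 * l ^ (-(1 - α)) * ‖B‖) ≤ 1 / 2 := by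
    have : Tendsto (fun l : ℝ => ‖ν‖ * (2 * l ^ (-(1 - α)) * ‖B‖)) atTop (𝓝 0) := by
      have := (((tendsto_rpow_neg_atTop (y := 1 - α) (by linarith)).const_mul 2).mul_const ‖B‖).const_mul ‖ν‖
      simpa using this
    obtain ⟨l, hl⟩ := ((this.eventually_le_const (by norm_num : (0:ℝ) < 1 / 2)).and
      (eventually_ge_atTop 1)).exists
    exact ⟨l, hl.2, hl.1⟩
  have hl0 : 0 < l := by linarith
  obtain ⟨S, R, hS, hSR, hRS, hS1, hS2⟩ := S_props hQ.isSelfAdjoint hF hFQ hpyth hl1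
  have hSQ : S * Q = Q * S := by
    rw [hS, add_mul, mul_add, hFQ, smul_mul_assoc, mul_smul_comm]
  have hRQ : R * Q = Q * R := by
    calc R * Q = R * Q * (S * R) := by rw [hSR, mul_one]
      _ = R * (S * Q) * R := by rw [hSQ]; noncomm_ring
      _ = (R * S) * Q * R := by noncomm_ring
      _ = Q * R := by rw [hRS, one_mul]
  have hJ' : S * μ * Q - Q * μ * S = PW Q (1 - α) * B * Q := by
    rw [← hJ, hS]
    simp only [add_mul, mul_add, smul_mul_assoc, mul_smul_comm]
    abel
  have hSP : S * PW Q (1 - α) = PW Q (1 - α) * S := PW_comm hSQ _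
  have hRP : R * PW Q (1 - α) = PW Q (1 - α) * R := PW_comm hRQ _
  have hPR : ‖PW Q (1 - α) * R‖ ≤ 2 * l ^ (-(1 - α)) := by
    refine opNorm_le_bound _ (by positivity) fun x => ?_
    change ‖PW Q (1 - α) (R x)‖ ≤ _
    refine (PW_interp hQ (by linarith) (by linarith) (inv_pos.mpr hl0) _).trans ?_
    have e : S (R x) = x := by
      change (S * R) x = x
      rw [hSR]; rfl
    have a1 := hS1 (R x)
    have a2 := hS2 (R x)
    rw [e] at a1 a2
    have e3 : l⁻¹ ^ (1 - α - 1) = l ^ (-(1 - α)) * l := by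
      rw [Real.inv_rpow hl0.le, ← Real.rpow_neg hl0.le, ← Real.rpow_add_one hl0.ne']
      congr 1; ring
    have e4 : l⁻¹ ^ (1 - α) = l ^ (-(1 - α)) := by
      rw [Real.inv_rpow hl0.le, ← Real.rpow_neg hl0.le]
    rw [e3, e4]
    have : 0 ≤ l ^ (-(1 - α)) := by positivity
    nlinarith
  -- key identity
  have key : μ * (Q * R) - (Q * R) * μ = (PW Q (1 - α) * R) * B * (Q * R) := by
    have : R * (S * μ * Q - Q * μ * S) * R = R * (PW Q (1 - α) * B * Q) * R := by rw [hJ']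
    calc μ * (Q * R) - (Q * R) * μ = (R * S) * μ * Q * R - (R * Q) * μ * (S * R) := by
          rw [hRS, hSR, hRQ]; noncomm_ring
      _ = R * (S * μ * Q - Q * μ * S) * R := by noncomm_ring
      _ = _ := by rw [this, ← hRP]; noncomm_ring
  set T := Q * R with hT
  set ε := 2 * l ^ (-(1 - α)) * ‖B‖ with hε
  have keyn : ∀ ζ, ‖μ (T ζ) - T (μ ζ)‖ ≤ ε * ‖T ζ‖ := by
    intro ζ
    have : μ (T ζ) - T (μ ζ) = ((PW Q (1 - α) * R) * B * T) ζ := by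
      rw [← key]; rfl
    rw [this]
    change ‖(PW Q (1 - α) * R) (B (T ζ))‖ ≤ _
    calc _ ≤ (2 * l ^ (-(1 - α))) * (‖B‖ * ‖T ζ‖) :=
          (le_opNorm (PW Q (1 - α) * R) _).trans (mul_le_mul hPR (le_opNorm _ _) (norm_nonneg _) (by positivity))
      _ = _ := by rw [hε]; ring
  have hTQ : ∀ ζ, ‖T ζ‖ ≤ ‖R‖ * ‖Q ζ‖ := by
    intro ζ
    have : T ζ = R (Q ζ) := by
      change (Q * R) ζ = (R * Q) ζ
      rw [hRQ]
    rw [this]; exact le_opNorm _ _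
  have hQT : ∀ ζ, ‖Q ζ‖ ≤ ‖S‖ * ‖T ζ‖ := by
    intro ζ
    have : Q ζ = S (T ζ) := by
      change Q ζ = (S * (Q * R)) ζ
      rw [← mul_assoc, hSQ, mul_assoc, hSR, mul_one]
    rw [this]; exact le_opNorm _ _
  have hε0 : 0 ≤ ε := by positivity
  constructor
  · refine ⟨‖S‖ * ((‖μ‖ + ε) * ‖R‖), fun ζ => ?_⟩
    have a1 : ‖T (μ ζ)‖ ≤ (‖μ‖ + ε) * ‖T ζ‖ := by
      have b1 := norm_sub_le (μ (T ζ)) (μ (T ζ) - T (μ ζ))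
      rw [sub_sub_cancel] at b1
      have b2 := keyn ζ
      have b3 := le_opNorm μ (T ζ)
      linarith
    calc _ ≤ ‖S‖ * ‖T (μ ζ)‖ := hQT _
      _ ≤ ‖S‖ * ((‖μ‖ + ε) * (‖R‖ * ‖Q ζ‖)) := by
          gcongr
          refine a1.trans ?_
          gcongr
          exact hTQ ζ
      _ = _ := by ring
  · refine ⟨‖S‖ * (2 * ‖ν‖ * ‖R‖), fun ζ => ?_⟩
    have a1 : ‖T ζ‖ ≤ 2 * ‖ν‖ * ‖T (μ ζ)‖ := by
      have b0 : T ζ = ν (μ (T ζ)) := by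
        change _ = (ν * μ) (T ζ)
        rw [hνμ]; rfl
      have b1 : ‖T ζ‖ ≤ ‖ν‖ * ‖μ (T ζ)‖ := by
        nth_rewrite 1 [b0]; exact le_opNorm _ _
      have b2 := norm_add_le (T (μ ζ)) (μ (T ζ) - T (μ ζ))
      rw [add_sub_cancel] at b2
      have b3 := keyn ζ
      have b4 : ‖ν‖ * ‖μ (T ζ)‖ ≤ ‖ν‖ * (‖T (μ ζ)‖ + ε * ‖T ζ‖) := by gcongr; linarith
      have b5 : ‖ν‖ * ε * ‖T ζ‖ ≤ 1 / 2 * ‖T ζ‖ := by gcongr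
      linarith
    calc _ ≤ ‖S‖ * ‖T ζ‖ := hQT _
      _ ≤ ‖S‖ * (2 * ‖ν‖ * (‖R‖ * ‖Q (μ ζ)‖)) := by
          gcongr
          refine a1.trans ?_
          gcongr
          exact hTQ _
      _ = _ := by ring

/-- commutator Sylvester identity -/
lemma comm_syl {F Q μ G : H →L[ℂ] H} (hQ : Q.IsPositive) (hQi : Function.Injective Q)
    (hFQ : F * Q = Q * F) (hpyth : F * F + Q * Q = 1) {p q : ℝ} (hq : 0 ≤ q) (hqp : q < p)
    (hp : p ≤ 1) (hJ : F * μ * Q - Q * μ * F = Q * G * PW Q p) :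
    ∃ N N' : H →L[ℂ] H, F * μ - μ * F = N * PW Q q ∧ (F * μ - μ * F) * PW Q (1 - q) = Q * N' := by
  set X := F * μ - μ * F with hX
  set V := G - F * G * F + Q * G * Q with hV
  have hFP : F * PW Q p = PW Q p * F := PW_comm hFQ p
  have hQP : Q * PW Q p = PW Q p * Q := PW_comm rfl p
  have hFF : F * F = 1 - Q * Q := eq_sub_of_add_eq hpyth
  have eq1 : Q * X + X * Q = Q * V * PW Q p := by
    set J := F * μ * Q - Q * μ * F with hJd
    have e1 : Q * V * PW Q p = J - F * J * F + Q * J * Q := by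
      rw [hJ, hV]
      calc _ = Q * G * PW Q p - (Q * F) * G * (F * PW Q p) + Q * Q * G * (Q * PW Q p) := by noncomm_ring
        _ = _ := by rw [hFP, hQP, ← hFQ]; noncomm_ring
    rw [e1, hJd, hX]
    have e2 : F * (F * μ * Q - Q * μ * F) * F = (F * F) * μ * (Q * F) - (F * Q) * μ * (F * F) := by
      noncomm_ring
    have e3 : Q * (F * μ * Q - Q * μ * F) * Q = (Q * F) * μ * (Q * Q) - Q * Q * μ * (F * Q) := by
      noncomm_ring
    rw [e2, e3, hFF, hFQ]
    have e4 : (F * μ - μ * F) * Q = F * μ * Q - μ * (F * Q) := by noncomm_ring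
    rw [e4, hFQ]
    noncomm_ring
  obtain ⟨N, hN⟩ := factor (T := X) (PW_sa Q q) (PW_inj hQ hQi hq (by linarith))
    (sylvester hQ hQi hQ hQi hq hqp hp eq1)
  refine ⟨N, V * PW Q (p - q) - N, hN, ?_⟩
  have e5 : (X * PW Q (1 - q)) * PW Q q = (Q * (V * PW Q (p - q) - N)) * PW Q q := by
    have a1 : PW Q (1 - q) * PW Q q = Q := by
      rw [← PW_add hQ (by linarith) hq, sub_add_cancel, PW_one hQ]
    have a2 : PW Q (p - q) * PW Q q = PW Q p := by
      rw [← PW_add hQ (by linarith) hq, sub_add_cancel]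
    calc _ = X * (PW Q (1 - q) * PW Q q) := by noncomm_ring
      _ = Q * V * PW Q p - Q * X := by rw [a1, ← eq1]; abel
      _ = Q * V * (PW Q (p - q) * PW Q q) - Q * (N * PW Q q) := by rw [a2, ← hN]
      _ = _ := by noncomm_ring
  have hd := dense_of_inj (PW_sa Q q) (PW_inj hQ hQi hq (by linarith))
  refine DFunLike.coe_injective ?_
  refine hd.equalizer (ContinuousLinearMap.continuous _) (ContinuousLinearMap.continuous _) ?_
  ext x
  exact congrArg (fun T : H →L[ℂ] H => T x) e5

end
end S19


open S19 ContinuousLinearMap in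
/-- **Multiplicative perturbation of the bounded transform.**  Let `D` be a self-adjoint
operator on a Hilbert space `H`, encoded by its bounded transform pair `(F, Q)`:
`F = F_D = D(1+D²)^{-1/2}`, `Q = ⟨D⟩⁻¹ = (1+D²)^{-1/2}` (`Q` positive injective, `F`
self-adjoint, `FQ = QF`, `F² + Q² = 1`, `dom D = ran Q`, `D(Qξ) = Fξ`).  Let `μ` be a
bounded invertible operator (inverse `ν`) with `μ(dom D) ⊆ dom D` such that both
`[D,μ]⟨D⟩^{-α}` and `⟨D⟩^{-α}[D,μ]` extend to bounded operators for some `0 ≤ α < 1`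
(hypotheses `hrel1`, `hrel2`, using `[D,μ](Qξ) = Fη - μ(Fξ)` where `μ(Qξ) = Qη`,
`⟨D⟩^α(Qξ) = Q^{1-α}ξ` and `⟨D⟩^{-α} = cfc (·^α) Q`).  Let `D₁ = μDμ*`, a self-adjoint
operator with domain `μ^{-1*}(dom D) = ν*(ran Q)` and `D₁(ν* Qξ) = μFξ`, encoded by its
bounded transform pair `(F₁, Q₁)` (hypothesis `hD₁`).  Then for every `0 ≤ β < 1 - α` the
operator `(F_{D₁} - F_D)⟨D⟩^β` is bounded, i.e. `‖F₁ζ - Fζ‖ ≤ C ‖Q^β ζ‖` for all `ζ`.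
(The cases `β < 0` are trivial and omitted.) -/
theorem stmt19 {H : Type*} [NormedAddCommGroup H] [InnerProductSpace ℂ H] [CompleteSpace H]
    (F Q : H →L[ℂ] H) (hQpos : Q.IsPositive) (hQinj : Function.Injective Q)
    (hF : IsSelfAdjoint F) (hFQ : F * Q = Q * F) (hpyth : F * F + Q * Q = 1)
    (μ ν : H →L[ℂ] H) (hμν : μ * ν = 1) (hνμ : ν * μ = 1)
    (hμdom : ∀ ξ : H, ∃ η : H, μ (Q ξ) = Q η)
    (α : ℝ) (hα0 : 0 ≤ α) (hα1 : α < 1)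
    (hrel1 : ∃ C : ℝ, ∀ (ξ η : H), μ (Q ξ) = Q η →
      ‖F η - μ (F ξ)‖ ≤ C * ‖cfc (fun t : ℝ => t ^ (1 - α)) Q ξ‖)
    (hrel2 : ∃ C : ℝ, ∀ (ξ η : H), μ (Q ξ) = Q η →
      ‖cfc (fun t : ℝ => t ^ α) Q (F η - μ (F ξ))‖ ≤ C * ‖Q ξ‖)
    (F₁ Q₁ : H →L[ℂ] H) (hQ₁pos : Q₁.IsPositive) (hQ₁inj : Function.Injective Q₁)
    (hF₁ : IsSelfAdjoint F₁) (hFQ₁ : F₁ * Q₁ = Q₁ * F₁) (hpyth₁ : F₁ * F₁ + Q₁ * Q₁ = 1)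
    (hD₁ : (∀ ξ : H, ∃ ζ : H, adjoint ν (Q ξ) = Q₁ ζ ∧ F₁ ζ = μ (F ξ)) ∧
      (∀ ζ : H, ∃ ξ : H, Q₁ ζ = adjoint ν (Q ξ))) :
    ∀ β : ℝ, 0 ≤ β → β < 1 - α →
      ∃ C : ℝ, ∀ ζ : H, ‖F₁ ζ - F ζ‖ ≤ C * ‖cfc (fun t : ℝ => t ^ β) Q ζ‖ := by
  intro β hβ0 hβ1
  have hQsa := hQpos.isSelfAdjoint
  -- the operator M = ⟨D⟩ μ ⟨D⟩⁻¹
  obtain ⟨M, hM⟩ := factor_left (T := μ * Q) hQinj hμdom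
  have hMx : ∀ ξ, μ (Q ξ) = Q (M ξ) := fun ξ => congrArg (fun T : H →L[ℂ] H => T ξ) hM
  set T := F * M - μ * F with hT
  have hQT : F * μ * Q - Q * μ * F = Q * T := by
    calc _ = F * (μ * Q) - Q * μ * F := by noncomm_ring
      _ = (F * Q) * M - Q * μ * F := by rw [hM]; noncomm_ring
      _ = _ := by rw [hFQ, hT]; noncomm_ring
  obtain ⟨G, hG⟩ : ∃ G : H →L[ℂ] H, T = G * PW Q (1 - α) := by
    refine factor (PW_sa Q _) (PW_inj hQpos hQinj (by linarith) (by linarith)) ?_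
    obtain ⟨C, hC⟩ := hrel1
    exact ⟨C, fun x => hC x (M x) (hMx x)⟩
  obtain ⟨B, hB⟩ : ∃ B : H →L[ℂ] H, PW Q α * T = B * Q := by
    refine factor hQsa hQinj ?_
    obtain ⟨C, hC⟩ := hrel2
    exact ⟨C, fun x => hC x (M x) (hMx x)⟩
  have hJ1 : F * μ * Q - Q * μ * F = Q * G * PW Q (1 - α) := by
    rw [hQT, hG, mul_assoc]
  have hQsplit : PW Q (1 - α) * PW Q α = Q := by
    rw [← PW_add hQpos (by linarith) hα0, sub_add_cancel, PW_one hQpos]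
  have hJ2 : F * μ * Q - Q * μ * F = PW Q (1 - α) * B * Q := by
    rw [hQT, mul_assoc, ← hB, ← mul_assoc, hQsplit]
  have hJ3 : F * star μ * Q - Q * star μ * F = Q * (-star B) * PW Q (1 - α) := by
    have := congrArg star hJ2
    simp only [star_sub, star_mul, hF.star_eq, hQsa.star_eq, (PW_sa Q (1 - α)).star_eq] at this
    calc _ = -(Q * (star μ * F) - F * (star μ * Q)) := by noncomm_ring
      _ = _ := by rw [this]; noncomm_ring
  obtain ⟨hup, hlow⟩ := apriori hQpos hF hFQ hpyth hνμ hα0 hα1 hJ2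
  -- exponents β < b < p < q < 1 - α
  obtain ⟨b, hb1, hb2⟩ := exists_between hβ1
  obtain ⟨p, hp1, hp2⟩ := exists_between hb2
  obtain ⟨q, hq1, hq2⟩ := exists_between hp2
  obtain ⟨N, _, hN, _⟩ := comm_syl hQpos hQinj hFQ hpyth (q := q) (by linarith) hq2 (by linarith) hJ1
  obtain ⟨_, N', _, hN'⟩ := comm_syl hQpos hQinj hFQ hpyth (q := q) (by linarith) hq2 (by linarith) hJ3
  -- factor star μ * Q through Q
  obtain ⟨M', hM'⟩ : ∃ M' : H →L[ℂ] H, star μ * Q = Q * M' := by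
    obtain ⟨A, hA⟩ := factor (T := Q * μ) hQsa hQinj hup
    refine ⟨star A, ?_⟩
    have := congrArg star hA
    simpa only [star_mul, hQsa.star_eq] using this
  set K : H →L[ℂ] H := star ν * Q * ν with hK
  have hsνμ : star μ * star ν = 1 := by rw [← star_mul, hνμ, star_one]
  have hsμν : star ν * star μ = 1 := by rw [← star_mul, hμν, star_one]
  have hKpos : K.IsPositive := by
    have := hQpos.adjoint_conj ν
    exact this
  have hνinj : Function.Injective ν := fun x y h => by
    have := congrArg μ h
    change (μ * ν) x = (μ * ν) y at this
    rwa [hμν] at this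
  have hsνinj : Function.Injective (star ν : H →L[ℂ] H) := fun x y h => by
    have := congrArg (fun z => (star μ : H →L[ℂ] H) z) h
    change (star μ * star ν) x = (star μ * star ν) y at this
    rwa [hsνμ] at this
  have hKinj : Function.Injective K := hsνinj.comp (hQinj.comp hνinj)
  have hKQ : ∃ C : ℝ, ∀ ζ, ‖K ζ‖ ≤ C * ‖Q ζ‖ := by
    obtain ⟨C, hC⟩ := hlow
    refine ⟨‖star ν‖ * C, fun ζ => ?_⟩
    have h1 := hC (ν ζ)
    have h2 : μ (ν ζ) = ζ := by
      change (μ * ν) ζ = ζ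
      rw [hμν]; rfl
    rw [h2] at h1
    calc ‖star ν (Q (ν ζ))‖ ≤ ‖star ν‖ * ‖Q (ν ζ)‖ := le_opNorm _ _
      _ ≤ ‖star ν‖ * (C * ‖Q ζ‖) := by gcongr
      _ = _ := by ring
  -- K = Q * C₀
  obtain ⟨C₀, hC₀⟩ : ∃ C₀ : H →L[ℂ] H, K = Q * C₀ := by
    obtain ⟨A, hA⟩ := factor (T := K) hQsa hQinj hKQ
    refine ⟨star A, ?_⟩
    have := congrArg star hA
    simpa only [star_mul, hQsa.star_eq, hKpos.isSelfAdjoint.star_eq] using this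
  -- K^{1-p} = Q^{1-q} * C₁
  obtain ⟨C₁, hC₁⟩ : ∃ C₁ : H →L[ℂ] H, PW K (1 - p) = PW Q (1 - q) * C₁ := by
    have h1 := heinz (A := K) (B := Q) (T := 1) hKpos hQpos hQinj (q := 1 - q) (p := 1 - p)
      (by linarith) (by linarith) (by linarith) hKQ
    obtain ⟨A, hA⟩ := factor (T := PW K (1 - p)) (PW_sa Q (1 - q))
      (PW_inj hQpos hQinj (by linarith) (by linarith)) h1
    refine ⟨star A, ?_⟩
    have := congrArg star hA
    simpa only [star_mul, (PW_sa K (1 - p)).star_eq, (PW_sa Q (1 - q)).star_eq] using this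
  -- Q^q ν = C₂ K^p
  obtain ⟨C₂, hC₂⟩ : ∃ C₂ : H →L[ℂ] H, PW Q q * ν = C₂ * PW K p := by
    have h0 : ∃ C : ℝ, ∀ ζ, ‖Q (ν ζ)‖ ≤ C * ‖K ζ‖ := by
      refine ⟨‖star μ‖, fun ζ => ?_⟩
      have : Q (ν ζ) = star μ (K ζ) := by
        change (Q * ν) ζ = (star μ * K) ζ
        rw [hK, ← mul_assoc, ← mul_assoc, hsνμ, one_mul]
      rw [this]
      exact le_opNorm _ _
    have h1 := heinz (A := Q) (B := K) (T := ν) hQpos hKpos hKinj (q := p) (p := q)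
      (by linarith) (by linarith) (by linarith) h0
    exact factor (T := PW Q q * ν) (PW_sa K p) (PW_inj hKpos hKinj (by linarith) (by linarith)) h1
  have hKsplit : PW K (1 - p) * PW K p = K := by
    rw [← PW_add hKpos (by linarith) (by linarith), sub_add_cancel, PW_one hKpos]
  -- intertwining of F₁ and F via Q₁
  have hint : F₁ * star ν * Q = Q₁ * μ * F := by
    ext ξ
    obtain ⟨ζ, h1, h2⟩ := hD₁.1 ξ
    change F₁ (adjoint ν (Q ξ)) = Q₁ (μ (F ξ))
    rw [h1, ← h2]
    exact congrArg (fun T : H →L[ℂ] H => T ζ) hFQ₁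
  have hFF : F * F = 1 - Q * Q := eq_sub_of_add_eq hpyth
  have hFF₁ : F₁ * F₁ = 1 - Q₁ * Q₁ := eq_sub_of_add_eq hpyth₁
  -- first part
  have hpart1 : F₁ * K - Q₁ * F = Q₁ * (-(N * C₂)) * PW K p := by
    calc F₁ * K - Q₁ * F = F₁ * star ν * Q * ν - Q₁ * F * (μ * ν) := by
          rw [hμν, hK]; noncomm_ring
      _ = -(Q₁ * (F * μ - μ * F) * ν) := by rw [hint]; noncomm_ring
      _ = -(Q₁ * N * (PW Q q * ν)) := by rw [hN]; noncomm_ring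
      _ = _ := by rw [hC₂]; noncomm_ring
  -- second part
  set E := N' * F * C₁ * PW K p with hE
  have hQE : Q * E = (F * star μ - star μ * F) * F * K := by
    have h1 : F * PW Q (1 - q) = PW Q (1 - q) * F := PW_comm hFQ _
    calc Q * E = (Q * N') * F * C₁ * PW K p := by rw [hE]; noncomm_ring
      _ = (F * star μ - star μ * F) * (PW Q (1 - q) * F) * C₁ * PW K p := by
          rw [← hN']; noncomm_ring
      _ = (F * star μ - star μ * F) * F * ((PW Q (1 - q) * C₁) * PW K p) := by
          rw [← h1]; noncomm_ring
      _ = _ := by rw [← hC₁, hKsplit]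
  set Y := M' * F * C₀ with hY
  have hFK : F * K = Q * F * C₀ := by rw [hC₀, ← mul_assoc, hFQ]
  have hQY : star μ * (F * K) = Q * Y := by
    rw [hFK, hY]
    calc _ = (star μ * Q) * F * C₀ := by noncomm_ring
      _ = _ := by rw [hM']; noncomm_ring
  have hsμK : star μ * K = Q * ν := by
    rw [hK, ← mul_assoc, ← mul_assoc, hsνμ, one_mul]
  have hE' : E - M' * Q * K + ν = F * Y := by
    have h1 : Q * (E - M' * Q * K + ν) = Q * (F * Y) := by
      calc Q * (E - M' * Q * K + ν) = Q * E - (Q * M') * Q * K + Q * ν := by noncomm_ring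
        _ = F * (star μ * (F * K)) - star μ * (F * F) * K - star μ * Q * Q * K + star μ * K := by
            rw [hQE, ← hM', hsμK]; noncomm_ring
        _ = F * (star μ * (F * K)) := by rw [hFF]; noncomm_ring
        _ = (F * Q) * Y := by rw [hQY]; noncomm_ring
        _ = _ := by rw [hFQ]; noncomm_ring
    ext x
    exact hQinj (congrArg (fun T : H →L[ℂ] H => T x) h1)
  have hkey : F₁ * (F * K) = Q₁ * μ * (F * Y) := by
    calc F₁ * (F * K) = F₁ * (star ν * star μ) * (F * K) := by rw [hsμν, mul_one]
      _ = F₁ * star ν * (star μ * (F * K)) := by noncomm_ring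
      _ = (F₁ * star ν * Q) * Y := by rw [hQY]; noncomm_ring
      _ = _ := by rw [hint]; noncomm_ring
  have hpart2' : F₁ * Q₁ - F * K = -(Q₁ * F₁ * μ * (E - M' * Q * K)) - Q₁ * Q₁ * (F * K) := by
    have h1 : E - M' * Q * K = F * Y - ν := by rw [← hE']; abel
    rw [h1]
    calc F₁ * Q₁ - F * K = F₁ * Q₁ - (1 - Q₁ * Q₁) * (F * K) - Q₁ * Q₁ * (F * K) := by noncomm_ring
      _ = F₁ * Q₁ * (μ * ν) - F₁ * (F₁ * (F * K)) - Q₁ * Q₁ * (F * K) := by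
          rw [← hFF₁, hμν]; noncomm_ring
      _ = (F₁ * Q₁) * μ * ν - (F₁ * Q₁) * μ * (F * Y) - Q₁ * Q₁ * (F * K) := by
          rw [hkey]; noncomm_ring
      _ = _ := by rw [hFQ₁]; noncomm_ring
  have hpart2 : F₁ * Q₁ - F * K = Q₁ * (-(F₁ * μ * (N' * F * C₁ - M' * Q * PW K (1 - p)))
      - Q₁ * F * PW K (1 - p)) * PW K p := by
    rw [hpart2', hE]
    calc _ = -(Q₁ * F₁ * μ * (N' * F * C₁ * PW K p - M' * Q * (PW K (1 - p) * PW K p)))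
          - Q₁ * Q₁ * (F * (PW K (1 - p) * PW K p)) := by rw [hKsplit]
      _ = _ := by noncomm_ring
  have hsyl : Q₁ * (F₁ - F) + (F₁ - F) * K = Q₁ * (-(N * C₂) +
      (-(F₁ * μ * (N' * F * C₁ - M' * Q * PW K (1 - p))) - Q₁ * F * PW K (1 - p))) * PW K p := by
    calc _ = (F₁ * K - Q₁ * F) + (Q₁ * F₁ - F * K) := by noncomm_ring
      _ = _ := by rw [← hFQ₁, hpart1, hpart2]; noncomm_ring
  obtain ⟨D₁, hD₁'⟩ := sylvester hQ₁pos hQ₁inj hKpos hKinj (β := b) (by linarith) hp1 (by linarith) hsyl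
  obtain ⟨D₂, hD₂⟩ := heinz (A := K) (B := Q) (T := 1) hKpos hQpos hQinj (q := β) (p := b)
      hβ0 hb1 (by linarith) hKQ
  refine ⟨|D₁| * D₂, fun ζ => ?_⟩
  calc ‖F₁ ζ - F ζ‖ ≤ D₁ * ‖PW K b ζ‖ := hD₁' ζ
    _ ≤ |D₁| * ‖PW K b ζ‖ := by gcongr; exact le_abs_self _
    _ ≤ |D₁| * (D₂ * ‖PW Q β ζ‖) := by gcongr; exact hD₂ ζ
    _ = |D₁| * D₂ * ‖PW Q β ζ‖ := by ring
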